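/- Let r be a positive integer, let Σ be a closed subset of ℝⁿ with 0 ∈ Σ, and let f: (ℝⁿ,0) → (ℝᵖ,0) be a C^{r+1} map-germ with n ≥ p. If there exist δ, C, α > 0 such that d(x,Σ)·κ(df(x)) + ‖f(x)‖ ≥ C·d(x,Σ)^{r+1−δ} for all ‖x‖ < α, then the relative r-jet j^r f(Σ;0) is Σ-V-sufficient in C^{r+1} mappings. -/

import Mathlib

/-- The Kuo distance `κ(v₁,…,v_p) = min_i dist(v_i, span{v_j : j ≠ i})`. -/
noncomputable def kuo {n p : ℕ} (v : Fin p → EuclideanSpace ℝ (Fin n)) : ℝ :=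
  ⨅ i : Fin p, Metric.infDist (v i)
    (Submodule.span ℝ (v '' {j | j ≠ i}) : Set (EuclideanSpace ℝ (Fin n)))

/-- The gradient of the `i`-th component of `f` at `x`, i.e. `df*(x)` applied to the
`i`-th standard basis vector. -/
noncomputable def grad {n p : ℕ} (f : EuclideanSpace ℝ (Fin n) → EuclideanSpace ℝ (Fin p))
    (x : EuclideanSpace ℝ (Fin n)) (i : Fin p) : EuclideanSpace ℝ (Fin n) :=
  ContinuousLinearMap.adjoint (fderiv ℝ f x) (EuclideanSpace.single i 1)

/-- `κ(df(x)) = κ(grad f₁(x),…,grad f_p(x))`. -/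
noncomputable def kuoD {n p : ℕ} (f : EuclideanSpace ℝ (Fin n) → EuclideanSpace ℝ (Fin p))
    (x : EuclideanSpace ℝ (Fin n)) : ℝ :=
  kuo (grad f x)

/-- `j^r f(Σ;0) = j^r g(Σ;0)`: all partial derivatives of order ≤ r of `f` and `g`
coincide on `Σ ∩ U` for some neighbourhood `U` of the origin. -/
def jetEqual {n p : ℕ} (r : ℕ) (S : Set (EuclideanSpace ℝ (Fin n)))
    (f g : EuclideanSpace ℝ (Fin n) → EuclideanSpace ℝ (Fin p)) : Prop :=
  ∃ U ∈ nhds (0 : EuclideanSpace ℝ (Fin n)), ∀ z ∈ S ∩ U, ∀ k : ℕ, k ≤ r →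
    iteratedFDeriv ℝ k f z = iteratedFDeriv ℝ k g z

/-- The relative r-jet `j^r f(Σ;0)` is `Σ`-`V`-sufficient in `C^s` mappings: any two `C^s`
realisations `g₁, g₂` of the relative jet have zero sets homeomorphic near the origin by a
homeomorphism fixing the points of `Σ`. -/
def SigmaVSufficient {n p : ℕ} (r s : ℕ) (S : Set (EuclideanSpace ℝ (Fin n)))
    (f : EuclideanSpace ℝ (Fin n) → EuclideanSpace ℝ (Fin p)) : Prop :=
  ∀ g₁ g₂ : EuclideanSpace ℝ (Fin n) → EuclideanSpace ℝ (Fin p),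
    ContDiff ℝ s g₁ → ContDiff ℝ s g₂ → g₁ 0 = 0 → g₂ 0 = 0 →
    jetEqual r S f g₁ → jetEqual r S f g₂ →
    ∃ U ∈ nhds (0 : EuclideanSpace ℝ (Fin n)), ∃ V ∈ nhds (0 : EuclideanSpace ℝ (Fin n)),
      ∃ h : (g₁ ⁻¹' {0} ∩ U : Set (EuclideanSpace ℝ (Fin n))) ≃ₜ
            (g₂ ⁻¹' {0} ∩ V : Set (EuclideanSpace ℝ (Fin n))),
        ∀ x : (g₁ ⁻¹' {0} ∩ U : Set (EuclideanSpace ℝ (Fin n))),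
          (x : EuclideanSpace ℝ (Fin n)) ∈ S → ((h x : EuclideanSpace ℝ (Fin n)) = x)

open Set Metric

lemma one_sub_mem_Icc {t : ℝ} (ht : t ∈ Icc (0 : ℝ) 1) : 1 - t ∈ Icc (0 : ℝ) 1 :=
  ⟨by linarith [ht.2], by linarith [ht.1]⟩

lemma HasDerivWithinAt.comp_one_sub {F : Type*} [NormedAddCommGroup F] [NormedSpace ℝ F]
    {u : ℝ → F} {u' : F} {t : ℝ} (h : HasDerivWithinAt u u' (Icc 0 1) (1 - t)) :
    HasDerivWithinAt (fun s => u (1 - s)) (-u') (Icc 0 1) t := by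
  have h2 : HasDerivWithinAt (fun t : ℝ => 1 - t) (-1) (Icc 0 1) t := by
    simpa using (hasDerivWithinAt_id t (Icc (0 : ℝ) 1)).const_sub 1
  simpa [Function.comp_def] using h.scomp t h2 fun s hs => one_sub_mem_Icc hs

/-- Linear growth of the derivative bounds a curve on `[0, 1]` from any of its values. -/
lemma norm_le_exp_mul_of_norm_deriv_le {F : Type*} [NormedAddCommGroup F] [NormedSpace ℝ F]
    {u u' : ℝ → F} {M : ℝ} (hM : 0 ≤ M)
    (hu : ∀ t ∈ Icc (0 : ℝ) 1, HasDerivWithinAt u (u' t) (Icc 0 1) t)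
    (hb : ∀ t ∈ Icc (0 : ℝ) 1, ‖u' t‖ ≤ M * ‖u t‖) {s t : ℝ}
    (hs : s ∈ Icc (0 : ℝ) 1) (ht : t ∈ Icc (0 : ℝ) 1) :
    ‖u t‖ ≤ Real.exp M * ‖u s‖ := by
  have forward : ∀ {v v' : ℝ → F},
      (∀ t ∈ Icc (0 : ℝ) 1, HasDerivWithinAt v (v' t) (Icc 0 1) t) →
      (∀ t ∈ Icc (0 : ℝ) 1, ‖v' t‖ ≤ M * ‖v t‖) → ∀ {s t : ℝ}, s ∈ Icc (0 : ℝ) 1 →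
      t ∈ Icc (0 : ℝ) 1 → s ≤ t → ‖v t‖ ≤ Real.exp M * ‖v s‖ := by
    intro v v' hv hb s t hs ht hst
    have hsub : ∀ {y}, y ∈ Icc s t → y ∈ Icc (0 : ℝ) 1 := fun hy =>
      ⟨hs.1.trans hy.1, hy.2.trans ht.2⟩
    have := norm_le_gronwallBound_of_norm_deriv_right_le (f := v) (f' := v') (δ := ‖v s‖)
      (K := M) (ε := 0) (a := s) (b := t)
      (fun y hy => ((hv y (hsub hy)).continuousWithinAt).mono fun _ h => hsub h)
      (fun y hy => (hv y (hsub ⟨hy.1, hy.2.le⟩)).mono_of_mem_nhdsWithin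
        (Icc_mem_nhdsGE_of_mem ⟨hs.1.trans hy.1, hy.2.trans_le ht.2⟩))
      le_rfl (fun y hy => by simpa using hb y (hsub ⟨hy.1, hy.2.le⟩)) t ⟨hst, le_rfl⟩
    rw [gronwallBound_ε0, mul_comm] at this
    refine this.trans (mul_le_mul_of_nonneg_right (Real.exp_le_exp.2 ?_) (norm_nonneg _))
    nlinarith [hs.1, ht.2]
  rcases le_total s t with hst | hst
  · exact forward hu hb hs ht hst
  · have := forward (v := fun t => u (1 - t)) (v' := fun t => -u' (1 - t))
      (fun t ht => (hu _ (one_sub_mem_Icc ht)).comp_one_sub)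
      (fun t ht => by simpa using hb _ (one_sub_mem_Icc ht))
      (one_sub_mem_Icc hs) (one_sub_mem_Icc ht) (by linarith)
    simpa using this

/-- Multiplying a bounded field, Lipschitz on `T ∩ s`, by a Lipschitz cutoff which vanishes
outside `T` gives a field which is Lipschitz on `s`. -/
lemma LipschitzOnWith.cutoff_smul {E F : Type*} [PseudoMetricSpace E] [NormedAddCommGroup F]
    [NormedSpace ℝ F] {T s : Set E} {φ : E → ℝ} {Y : E → F} {A K L : NNReal}
    (hφ : LipschitzWith A φ) (hφ1 : ∀ x, |φ x| ≤ 1) (hφ0 : ∀ x, x ∉ T → φ x = 0)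
    (hY : LipschitzOnWith K Y (T ∩ s)) (hb : ∀ x ∈ T ∩ s, ‖Y x‖ ≤ L) :
    LipschitzOnWith (A * L + K) (fun x => φ x • Y x) s := by
  have key : ∀ x ∈ s, ∀ y ∈ s, x ∈ T →
      dist (φ x • Y x) (φ y • Y y) ≤ (A * L + K : NNReal) * dist x y := by
    intro x hx y hy hxT
    have h1 := hφ.dist_le_mul x y
    rw [Real.dist_eq] at h1
    have h2 := hb x ⟨hxT, hx⟩
    have h3 : |φ x - φ y| * ‖Y x‖ ≤ (A * dist x y) * L :=
      mul_le_mul h1 h2 (norm_nonneg _) (by positivity)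
    by_cases hyT : y ∈ T
    · have h4 := hY.dist_le_mul x ⟨hxT, hx⟩ y ⟨hyT, hy⟩
      rw [dist_eq_norm] at h4 ⊢
      have h5 : φ x • Y x - φ y • Y y = (φ x - φ y) • Y x + φ y • (Y x - Y y) := by
        rw [sub_smul, smul_sub]; abel
      rw [h5]
      refine (norm_add_le _ _).trans ?_
      rw [norm_smul, norm_smul, Real.norm_eq_abs, Real.norm_eq_abs]
      have h6 : |φ y| * ‖Y x - Y y‖ ≤ 1 * (K * dist x y) :=
        mul_le_mul (hφ1 y) h4 (norm_nonneg _) zero_le_one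
      push_cast
      linarith
    · rw [hφ0 y hyT, sub_zero] at h3
      rw [hφ0 y hyT, zero_smul, dist_zero_right, norm_smul, Real.norm_eq_abs]
      push_cast
      have : 0 ≤ (K : ℝ) * dist x y := by positivity
      linarith
  refine LipschitzOnWith.of_dist_le_mul fun x hx y hy => ?_
  by_cases hxT : x ∈ T
  · exact key x hx y hy hxT
  by_cases hyT : y ∈ T
  · rw [dist_comm, dist_comm x y]
    exact key y hy x hx hyT
  · rw [hφ0 x hxT, hφ0 y hyT]
    simp only [zero_smul, dist_self]
    positivity

/-- The affine function `a ↦ a`, clamped to `[0, 1]`. -/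
noncomputable def unitClamp (a : ℝ) : ℝ := max 0 (min 1 a)

lemma lipschitzWith_unitClamp : LipschitzWith 1 unitClamp :=
  (LipschitzWith.id.const_min 1).const_max 0

lemma unitClamp_nonneg (a : ℝ) : 0 ≤ unitClamp a := le_max_left _ _

lemma unitClamp_le_one (a : ℝ) : unitClamp a ≤ 1 := max_le zero_le_one (min_le_left _ _)

lemma abs_unitClamp_le_one (a : ℝ) : |unitClamp a| ≤ 1 := by
  rw [abs_of_nonneg (unitClamp_nonneg a)]; exact unitClamp_le_one a

lemma unitClamp_of_nonpos {a : ℝ} (h : a ≤ 0) : unitClamp a = 0 := by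
  rw [unitClamp, min_eq_right (by linarith), max_eq_left h]

lemma unitClamp_of_one_le {a : ℝ} (h : 1 ≤ a) : unitClamp a = 1 := by
  rw [unitClamp, min_eq_left h, max_eq_right zero_le_one]

/-- A bounded time-dependent vector field on `[0, 1]` which is dominated by the distance to `S`
and Lipschitz away from `S`. -/
structure IsTameField {E : Type*} [NormedAddCommGroup E] (S : Set E) (M : ℝ) (L : NNReal)
    (X : ℝ → E → E) : Prop where
  norm_le : ∀ t ∈ Icc (0 : ℝ) 1, ∀ x, ‖X t x‖ ≤ M * infDist x S
  bound : ∀ t ∈ Icc (0 : ℝ) 1, ∀ x, ‖X t x‖ ≤ L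
  lipschitz : ∀ ε > 0, ∃ K : NNReal, ∀ t ∈ Icc (0 : ℝ) 1,
    LipschitzOnWith K (X t) {x | ε ≤ infDist x S}
  cont : ∀ x, ContinuousOn (X · x) (Icc 0 1)

namespace IsTameField

variable {E : Type*} [NormedAddCommGroup E] {S : Set E} {M : ℝ} {L : NNReal}
  {X : ℝ → E → E}

lemma reverse (hX : IsTameField S M L X) : IsTameField S M L (fun t x => -X (1 - t) x) where
  norm_le t ht x := by simpa using hX.norm_le _ (one_sub_mem_Icc ht) x
  bound t ht x := by simpa using hX.bound _ (one_sub_mem_Icc ht) x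
  lipschitz ε hε := by
    obtain ⟨K, hK⟩ := hX.lipschitz ε hε
    exact ⟨K, fun t ht => (hK _ (one_sub_mem_Icc ht)).neg⟩
  cont x := ((hX.cont x).comp (by fun_prop) (fun t ht => one_sub_mem_Icc ht)).neg

variable [NormedSpace ℝ E]

lemma reverse_curve {γ : ℝ → E} (hγ : IsIntegralCurveOn γ X (Icc 0 1)) :
    IsIntegralCurveOn (fun t => γ (1 - t)) (fun t x => -X (1 - t) x) (Icc 0 1) := by
  intro t ht
  exact (hγ _ (one_sub_mem_Icc ht)).comp_one_sub

lemma norm_sub_le (hM : 0 ≤ M) (hX : ∀ t ∈ Icc (0 : ℝ) 1, ∀ x, ‖X t x‖ ≤ M * infDist x S)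
    {γ : ℝ → E} (hγ : IsIntegralCurveOn γ X (Icc 0 1)) {s t : ℝ} (hs : s ∈ Icc (0 : ℝ) 1)
    (ht : t ∈ Icc (0 : ℝ) 1) {z : E} (hz : z ∈ S) :
    ‖γ t - z‖ ≤ Real.exp M * ‖γ s - z‖ :=
  norm_le_exp_mul_of_norm_deriv_le (u := fun t => γ t - z) hM
    (fun t ht => (hγ t ht).sub_const z)
    (fun t ht => (hX t ht _).trans (mul_le_mul_of_nonneg_left
      (by simpa [dist_eq_norm] using infDist_le_dist_of_mem (x := γ t) hz) hM)) hs ht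

lemma infDist_le (hM : 0 ≤ M) (hS : S.Nonempty)
    (hX : ∀ t ∈ Icc (0 : ℝ) 1, ∀ x, ‖X t x‖ ≤ M * infDist x S)
    {γ : ℝ → E} (hγ : IsIntegralCurveOn γ X (Icc 0 1)) {s t : ℝ} (hs : s ∈ Icc (0 : ℝ) 1)
    (ht : t ∈ Icc (0 : ℝ) 1) :
    Real.exp (-M) * infDist (γ t) S ≤ infDist (γ s) S := by
  refine (le_infDist hS).2 fun z hz => ?_
  have h1 := norm_sub_le hM hX hγ hs ht hz
  have h2 := infDist_le_dist_of_mem (x := γ t) hz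
  rw [dist_eq_norm] at h2 ⊢
  calc Real.exp (-M) * infDist (γ t) S
      ≤ Real.exp (-M) * (Real.exp M * ‖γ s - z‖) := by gcongr; exact h2.trans h1
    _ = ‖γ s - z‖ := by rw [← mul_assoc, ← Real.exp_add]; simp

lemma eq_of_mem (hM : 0 ≤ M) (hX : IsTameField S M L X)
    {γ : ℝ → E} (hγ : IsIntegralCurveOn γ X (Icc 0 1)) {s t : ℝ} (hs : s ∈ Icc (0 : ℝ) 1)
    (ht : t ∈ Icc (0 : ℝ) 1) (h : γ s ∈ S) : γ t = γ s := by
  have := norm_sub_le hM hX.norm_le hγ hs ht h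
  simpa [sub_eq_zero] using this

lemma exists_curve [CompleteSpace E] (hM : 0 ≤ M) (hS : IsClosed S) (hne : S.Nonempty)
    (hX : IsTameField S M L X) (x : E) :
    ∃ γ : ℝ → E, γ 0 = x ∧ IsIntegralCurveOn γ X (Icc 0 1) := by
  by_cases hx : x ∈ S
  · refine ⟨fun _ => x, rfl, fun t ht => ?_⟩
    have h0 : X t x = 0 := by
      simpa [infDist_zero_of_mem hx] using hX.norm_le t ht x
    simpa only [h0] using hasDerivWithinAt_const t (Icc (0 : ℝ) 1) x
  have hd : 0 < infDist x S := (hS.notMem_iff_infDist_pos hne).1 hx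
  set ε := Real.exp (-M) * infDist x S / 2 with hε
  have hε0 : 0 < ε := by positivity
  obtain ⟨K, hK⟩ := hX.lipschitz ε hε0
  set χ : E → ℝ := fun y => unitClamp (ε⁻¹ * infDist y S - 1) with hχ
  have hχlip : LipschitzWith (Real.toNNReal ε⁻¹) χ := by
    refine LipschitzWith.of_dist_le_mul fun y z => ?_
    refine (lipschitzWith_unitClamp.dist_le_mul _ _).trans ?_
    have := (lipschitz_infDist_pt S).dist_le_mul y z
    rw [Real.dist_eq] at this ⊢
    rw [Real.coe_toNNReal _ (by positivity),
      show ε⁻¹ * infDist y S - 1 - (ε⁻¹ * infDist z S - 1)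
        = ε⁻¹ * (infDist y S - infDist z S) by ring, abs_mul, abs_of_pos (inv_pos.2 hε0)]
    simp only [NNReal.coe_one, one_mul] at this ⊢
    gcongr
  have hχ0 : ∀ y, y ∉ {y | ε ≤ infDist y S} → χ y = 0 := by
    intro y hy
    apply unitClamp_of_nonpos
    have : ε⁻¹ * infDist y S ≤ ε⁻¹ * ε := by
      gcongr
      exact (not_le.1 hy).le
    rw [inv_mul_cancel₀ hε0.ne'] at this
    linarith
  have hχ1 : ∀ y, 2 * ε ≤ infDist y S → χ y = 1 := by
    intro y hy
    apply unitClamp_of_one_le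
    have : ε⁻¹ * (2 * ε) ≤ ε⁻¹ * infDist y S := by gcongr
    rw [mul_left_comm, inv_mul_cancel₀ hε0.ne'] at this
    linarith
  have hYle : ∀ t y, ‖χ y • X t y‖ ≤ ‖X t y‖ := by
    intro t y
    rw [norm_smul]
    exact mul_le_of_le_one_left (norm_nonneg _) (abs_unitClamp_le_one _)
  have hPL : IsPicardLindelof (fun t y => χ y • X t y)
      (⟨0, by simp⟩ : Icc (0 : ℝ) 1) x L 0 L (Real.toNNReal ε⁻¹ * L + K) := by
    refine ⟨fun t ht => ?_, fun y _ => ?_, fun t ht y _ => ?_, ?_⟩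
    · refine LipschitzOnWith.cutoff_smul (T := {y | ε ≤ infDist y S}) hχlip
        (fun y => abs_unitClamp_le_one _) hχ0 ((hK t ht).mono inter_subset_left)
        fun y _ => hX.bound t ht y
    · exact (hX.cont y).const_smul (χ y)
    · exact (hYle t y).trans (hX.bound t ht y)
    · simp
  obtain ⟨γ, hγ0, hγ⟩ := hPL.exists_eq_forall_mem_Icc_hasDerivWithinAt₀
  refine ⟨γ, hγ0, fun t ht => ?_⟩
  have h1 := infDist_le hM hne (fun t ht y => (hYle t y).trans (hX.norm_le t ht y)) hγ ht
    (t := 0) (by simp)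
  have h2 : χ (γ t) = 1 := hχ1 _ (by
    have : γ 0 = x := hγ0
    rw [this] at h1
    linarith)
  simpa only [h2, one_smul] using hγ t ht

lemma dist_le {ε : ℝ} (hM : 0 ≤ M) (hne : S.Nonempty) (hX : IsTameField S M L X) {K : NNReal}
    (hK : ∀ t ∈ Icc (0 : ℝ) 1, LipschitzOnWith K (X t) {x | ε ≤ infDist x S})
    {γ₁ γ₂ : ℝ → E} (h₁ : IsIntegralCurveOn γ₁ X (Icc 0 1))
    (h₂ : IsIntegralCurveOn γ₂ X (Icc 0 1)) (hε₁ : ε ≤ Real.exp (-M) * infDist (γ₁ 0) S)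
    (hε₂ : ε ≤ Real.exp (-M) * infDist (γ₂ 0) S) {t : ℝ} (ht : t ∈ Icc (0 : ℝ) 1) :
    dist (γ₁ t) (γ₂ t) ≤ dist (γ₁ 0) (γ₂ 0) * Real.exp (K * t) := by
  have hsub : ∀ {t : ℝ}, t ∈ Ico (0 : ℝ) 1 → t ∈ Icc (0 : ℝ) 1 := fun h => Ico_subset_Icc_self h
  have := dist_le_of_trajectories_ODE_of_mem (v := X) (s := fun _ => {x | ε ≤ infDist x S})
    (K := K) (a := 0) (b := 1) (δ := dist (γ₁ 0) (γ₂ 0)) (fun t ht => hK t (hsub ht))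
    h₁.continuousOn
    (fun t ht => (h₁ t (hsub ht)).mono_of_mem_nhdsWithin (Icc_mem_nhdsGE_of_mem ht))
    (fun t ht => hε₁.trans (infDist_le hM hne hX.norm_le h₁ (hsub ht) (by simp)))
    h₂.continuousOn
    (fun t ht => (h₂ t (hsub ht)).mono_of_mem_nhdsWithin (Icc_mem_nhdsGE_of_mem ht))
    (fun t ht => hε₂.trans (infDist_le hM hne hX.norm_le h₂ (hsub ht) (by simp)))
    le_rfl t ht
  simpa using this

lemma curve_unique (hM : 0 ≤ M) (hS : IsClosed S) (hne : S.Nonempty) (hX : IsTameField S M L X)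
    {γ₁ γ₂ : ℝ → E} (h₁ : IsIntegralCurveOn γ₁ X (Icc 0 1))
    (h₂ : IsIntegralCurveOn γ₂ X (Icc 0 1)) (h : γ₁ 0 = γ₂ 0) {t : ℝ}
    (ht : t ∈ Icc (0 : ℝ) 1) : γ₁ t = γ₂ t := by
  by_cases hx : γ₁ 0 ∈ S
  · rw [eq_of_mem hM hX h₁ (s := 0) (by simp) ht hx,
      eq_of_mem hM hX h₂ (s := 0) (by simp) ht (h ▸ hx), h]
  have hd : 0 < infDist (γ₁ 0) S := (hS.notMem_iff_infDist_pos hne).1 hx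
  obtain ⟨K, hK⟩ := hX.lipschitz (Real.exp (-M) * infDist (γ₁ 0) S) (by positivity)
  have := dist_le hM hne hX hK h₁ h₂ le_rfl (by rw [h]) ht
  rw [h, dist_self, zero_mul] at this
  exact dist_le_zero.1 this

lemma continuous_time_one (hM : 0 ≤ M) (hS : IsClosed S) (hne : S.Nonempty)
    (hX : IsTameField S M L X) {γ : E → ℝ → E} (h0 : ∀ x, γ x 0 = x)
    (hγ : ∀ x, IsIntegralCurveOn (γ x) X (Icc 0 1)) : Continuous fun x => γ x 1 := by
  refine continuous_iff_continuousAt.2 fun x => ?_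
  by_cases hx : x ∈ S
  · refine continuousAt_of_locally_lipschitz (r := 1) one_pos (Real.exp M) fun y _ => ?_
    have h1 := norm_sub_le hM hX.norm_le (hγ y) (s := 0) (t := 1) (by simp) (by simp) hx
    have h2 : γ x 1 = x := by
      rw [eq_of_mem hM hX (hγ x) (s := 0) (t := 1) (by simp) (by simp) (by rwa [h0]), h0]
    rw [h2, dist_eq_norm, dist_eq_norm]
    simpa [h0] using h1
  have hd : 0 < infDist x S := (hS.notMem_iff_infDist_pos hne).1 hx
  obtain ⟨K, hK⟩ := hX.lipschitz (Real.exp (-M) * (infDist x S / 2)) (by positivity)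
  refine continuousAt_of_locally_lipschitz (r := infDist x S / 2) (by positivity)
    (Real.exp K) fun y hy => ?_
  have h1 : infDist x S / 2 ≤ infDist y S := by
    have := infDist_le_infDist_add_dist (s := S) (x := x) (y := y)
    rw [dist_comm] at this
    linarith
  have := dist_le hM hne hX hK (hγ y) (hγ x) (by rw [h0]; gcongr)
    (by rw [h0]; gcongr; linarith) (t := 1) (by simp)
  rw [h0, h0, mul_one, mul_comm] at this
  exact this

/-- The time-one map of a tame field is a homeomorphism. -/
theorem exists_homeomorph [CompleteSpace E] (hM : 0 ≤ M) (hS : IsClosed S) (hne : S.Nonempty)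
    (hX : IsTameField S M L X) :
    ∃ H : E ≃ₜ E, ∀ x, ∃ γ : ℝ → E, γ 0 = x ∧ γ 1 = H x ∧ IsIntegralCurveOn γ X (Icc 0 1) := by
  choose γ hγ0 hγ using hX.exists_curve hM hS hne
  choose σ hσ0 hσ using hX.reverse.exists_curve hM hS hne
  refine ⟨⟨⟨fun x => γ x 1, fun x => σ x 1, fun x => ?_, fun x => ?_⟩,
    hX.continuous_time_one hM hS hne hγ0 hγ,
    hX.reverse.continuous_time_one hM hS hne hσ0 hσ⟩, fun x => ⟨γ x, hγ0 x, rfl, hγ x⟩⟩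
  · have := hX.reverse.curve_unique hM hS hne (hσ (γ x 1)) (reverse_curve (hγ x))
      (by simp [hσ0]) (t := 1) (by simp)
    simpa [hγ0] using this
  · have h := reverse_curve (hσ x)
    simp only [sub_sub_cancel, neg_neg] at h
    have := hX.curve_unique hM hS hne (hγ (σ x 1)) h (by simp [hγ0]) (t := 1) (by simp)
    simpa [hσ0] using this

end IsTameField

open ContinuousLinearMap in
/-- Tikhonov-regularised solution of `A X = -h`. -/
noncomputable def regSolve {E F : Type*} [NormedAddCommGroup E] [InnerProductSpace ℝ E]
    [NormedAddCommGroup F] [InnerProductSpace ℝ F] [CompleteSpace E] [CompleteSpace F]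
    (A : E →L[ℝ] F) (ε : ℝ) (h : F) : E :=
  -(adjoint A) (Ring.inverse (A ∘L adjoint A + ε • (1 : F →L[ℝ] F)) h)

section RegSolve

open ContinuousLinearMap

variable {E F : Type*} [NormedAddCommGroup E] [InnerProductSpace ℝ E]
  [NormedAddCommGroup F] [InnerProductSpace ℝ F] [FiniteDimensional ℝ E] [FiniteDimensional ℝ F]
  {A : E →L[ℝ] F} {s m : ℝ} {h : F}

lemma inner_regularised (A : E →L[ℝ] F) (ε : ℝ) (w : F) :
    inner ℝ ((A ∘L adjoint A + ε • (1 : F →L[ℝ] F)) w) w = ‖adjoint A w‖ ^ 2 + ε * ‖w‖ ^ 2 := by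
  have h : (A ∘L adjoint A + ε • (1 : F →L[ℝ] F)) w = A (adjoint A w) + ε • w := rfl
  rw [h, inner_add_left, ← adjoint_inner_right, real_inner_smul_left, real_inner_self_eq_norm_sq,
    real_inner_self_eq_norm_sq]

lemma isUnit_regularised {ε : ℝ} (hm : 0 < m)
    (hA : ∀ w, m ^ 2 * ‖w‖ ^ 2 ≤ ‖adjoint A w‖ ^ 2 + ε * ‖w‖ ^ 2) :
    IsUnit (A ∘L adjoint A + ε • (1 : F →L[ℝ] F)) := by
  rw [ContinuousLinearMap.isUnit_iff_isUnit_toLinearMap, LinearMap.isUnit_iff_ker_eq_bot,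
    LinearMap.ker_eq_bot']
  intro w hw
  have h1 := inner_regularised A ε w
  have h2 : (A ∘L adjoint A + ε • (1 : F →L[ℝ] F)) w = 0 := hw
  rw [h2, inner_zero_left] at h1
  have h3 := hA w
  rw [← h1] at h3
  have : ‖w‖ ^ 2 ≤ 0 := by
    by_contra! hc
    nlinarith [mul_pos (pow_pos hm 2) hc]
  simpa using le_antisymm this (by positivity)

lemma norm_regSolve_le (hm : 0 < m) (hs : 0 ≤ s)
    (hA : ∀ w, m ^ 2 * ‖w‖ ^ 2 ≤ ‖adjoint A w‖ ^ 2 + s ^ 2 * ‖w‖ ^ 2) :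
    ‖regSolve A (s ^ 2) h‖ ≤ ‖h‖ / m ∧
      ‖h + A (regSolve A (s ^ 2) h)‖ ≤ s * (‖h‖ / m) := by
  set Q : F →L[ℝ] F := A ∘L adjoint A + s ^ 2 • (1 : F →L[ℝ] F) with hQ
  set w := Ring.inverse Q h with hw
  have hQw : Q w = h := by
    exact DFunLike.congr_fun (Ring.mul_inverse_cancel Q (isUnit_regularised hm hA)) h
  have hX : regSolve A (s ^ 2) h = -(adjoint A w) := rfl
  have h1 : ‖adjoint A w‖ ^ 2 + s ^ 2 * ‖w‖ ^ 2 ≤ ‖h‖ * ‖w‖ := by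
    rw [← inner_regularised, ← hQ, hQw]
    exact real_inner_le_norm _ _
  have h2 := (hA w).trans h1
  have h3 : m ^ 2 * ‖w‖ ≤ ‖h‖ := by
    rcases (norm_nonneg w).eq_or_lt with h0 | h0
    · rw [← h0]; simp
    · nlinarith
  have h4 : ‖h‖ * ‖w‖ ≤ (‖h‖ / m) ^ 2 := by
    rw [div_pow, le_div_iff₀ (by positivity)]
    nlinarith [norm_nonneg h]
  refine ⟨?_, ?_⟩
  · rw [hX, norm_neg]
    refine abs_le_of_sq_le_sq' ?_ (by positivity) |>.2
    nlinarith [sq_nonneg (s * ‖w‖)]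
  · have h5 : h + A (regSolve A (s ^ 2) h) = s ^ 2 • w := by
      rw [hX, map_neg]
      nth_rw 1 [← hQw]
      simp [hQ]
    rw [h5, norm_smul, Real.norm_eq_abs, abs_of_nonneg (sq_nonneg s), pow_two, mul_assoc]
    gcongr
    refine abs_le_of_sq_le_sq' ?_ (by positivity) |>.2
    nlinarith [sq_nonneg ‖adjoint A w‖]

lemma norm_adjoint_sub_le (A B : E →L[ℝ] F) (w : F) :
    ‖adjoint A w‖ ≤ ‖adjoint B w‖ + ‖A - B‖ * ‖w‖ := by
  have h1 : ‖adjoint A w - adjoint B w‖ ≤ ‖A - B‖ * ‖w‖ := by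
    rw [← sub_apply, ← map_sub, ← (adjoint (𝕜 := ℝ) (E := E) (F := F)).norm_map (A - B)]
    exact le_opNorm _ _
  linarith [norm_le_norm_add_norm_sub' (adjoint A w) (adjoint B w)]

lemma contDiff_adjoint : ContDiff ℝ 1 (fun A : E →L[ℝ] F => adjoint A) := by
  let L : (E →L[ℝ] F) →ₗ[ℝ] (F →L[ℝ] E) :=
    { toFun := fun A => adjoint A
      map_add' := fun A B => map_add _ _ _
      map_smul' := fun c A => by simp }
  exact (LinearMap.toContinuousLinearMap L).contDiff

lemma ContDiffAt.regSolve {G : Type*} [NormedAddCommGroup G] [NormedSpace ℝ G]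
    {A : G → E →L[ℝ] F} {ε : G → ℝ} {h : G → F} {y : G} (hA : ContDiffAt ℝ 1 A y)
    (hε : ContDiffAt ℝ 1 ε y) (hh : ContDiffAt ℝ 1 h y)
    (hu : IsUnit (A y ∘L adjoint (A y) + ε y • (1 : F →L[ℝ] F))) :
    ContDiffAt ℝ 1 (fun y => _root_.regSolve (A y) (ε y) (h y)) y := by
  have hadj : ContDiffAt ℝ 1 (fun y => adjoint (A y)) y := contDiff_adjoint.contDiffAt.comp y hA
  have hQ : ContDiffAt ℝ 1 (fun y => A y ∘L adjoint (A y) + ε y • (1 : F →L[ℝ] F)) y :=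
    (hA.clm_comp hadj).add (hε.smul contDiffAt_const)
  obtain ⟨q, hq⟩ := hu
  have hinv : ContDiffAt ℝ 1
      (fun y => Ring.inverse (A y ∘L adjoint (A y) + ε y • (1 : F →L[ℝ] F))) y := by
    have h1 := contDiffAt_ringInverse (n := 1) ℝ q
    rw [hq] at h1
    exact h1.comp y hQ
  exact (hadj.clm_apply (hinv.clm_apply hh)).neg

end RegSolve

lemma kuo_nonneg {n p : ℕ} (v : Fin p → EuclideanSpace ℝ (Fin n)) : 0 ≤ kuo v :=
  Real.iInf_nonneg fun _ => infDist_nonneg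

lemma kuo_mul_abs_le {n p : ℕ} (v : Fin p → EuclideanSpace ℝ (Fin n)) (c : Fin p → ℝ)
    (i : Fin p) : kuo v * |c i| ≤ ‖∑ j, c j • v j‖ := by
  by_cases hc : c i = 0
  · simp [hc]
  have h1 : kuo v ≤ infDist (v i) (Submodule.span ℝ (v '' {j | j ≠ i})) :=
    ciInf_le ⟨0, by rintro _ ⟨j, rfl⟩; exact infDist_nonneg⟩ i
  set y : EuclideanSpace ℝ (Fin n) := ∑ j ∈ Finset.univ.erase i, (-(c i)⁻¹ * c j) • v j with hy
  have hymem : y ∈ Submodule.span ℝ (v '' {j | j ≠ i}) :=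
    Submodule.sum_mem _ fun j hj => Submodule.smul_mem _ _
      (Submodule.subset_span ⟨j, Finset.ne_of_mem_erase hj, rfl⟩)
  have h2 := h1.trans (infDist_le_dist_of_mem (x := v i) hymem)
  have h3 : ∑ j, c j • v j = c i • (v i - y) := by
    rw [← Finset.add_sum_erase _ _ (Finset.mem_univ i), hy, smul_sub, sub_eq_add_neg,
      Finset.smul_sum, ← Finset.sum_neg_distrib]
    congr 1
    refine Finset.sum_congr rfl fun j _ => ?_
    rw [smul_smul, ← neg_smul]
    congr 1
    field_simp
  rw [h3, norm_smul, mul_comm, Real.norm_eq_abs, ← dist_eq_norm]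
  gcongr

lemma kuoD_mul_norm_le {n p : ℕ} (f : EuclideanSpace ℝ (Fin n) → EuclideanSpace ℝ (Fin p))
    (x : EuclideanSpace ℝ (Fin n)) (w : EuclideanSpace ℝ (Fin p)) :
    kuoD f x * ‖w‖ ≤ p * ‖ContinuousLinearMap.adjoint (fderiv ℝ f x) w‖ := by
  have hw : w = ∑ j, w j • EuclideanSpace.single j (1 : ℝ) := by
    ext i
    simp [Finset.sum_apply, Pi.single_apply]
  have h1 : ContinuousLinearMap.adjoint (fderiv ℝ f x) w = ∑ j, w j • grad f x j := by
    conv_lhs => rw [hw]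
    simp [grad, map_sum]
  have h2 : ‖w‖ ≤ ∑ j, |w j| := by
    conv_lhs => rw [hw]
    refine (norm_sum_le _ _).trans (Finset.sum_le_sum fun j _ => ?_)
    simp [norm_smul]
  calc kuoD f x * ‖w‖ ≤ kuoD f x * ∑ j, |w j| := by
        gcongr
        exact kuo_nonneg _
    _ = ∑ j, kuo (grad f x) * |w j| := by rw [Finset.mul_sum]; rfl
    _ ≤ ∑ _j : Fin p, ‖∑ j, w j • grad f x j‖ := Finset.sum_le_sum fun j _ =>
        kuo_mul_abs_le _ (fun j => w j) j
    _ = _ := by rw [h1]; simp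

/-- If the jet of order `r` of a `C^{r+1}` map vanishes at `z`, then its derivative of order
`r + 1 - j` is `O(R^j)` at distance `R` of `z`. -/
lemma norm_iteratedFDeriv_le_of_jet_eq_zero {E F : Type*} [NormedAddCommGroup E]
    [NormedSpace ℝ E] [NormedAddCommGroup F] [NormedSpace ℝ F] {u : E → F} {r : ℕ} {z : E}
    {R D : ℝ} (hu : ContDiff ℝ (r + 1 : ℕ) u) (hR : 0 ≤ R)
    (hz : ∀ k ≤ r, iteratedFDeriv ℝ k u z = 0)
    (hD : ∀ y ∈ closedBall z R, ‖iteratedFDeriv ℝ (r + 1) u y‖ ≤ D) {j k : ℕ}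
    (hjk : j + k = r + 1) : ∀ y ∈ closedBall z R, ‖iteratedFDeriv ℝ k u y‖ ≤ D * R ^ j := by
  induction j generalizing k with
  | zero =>
    obtain rfl : k = r + 1 := by omega
    simpa using hD
  | succ j ih =>
    intro y hy
    have h1 := (convex_closedBall z R).norm_image_sub_le_of_norm_fderiv_le (𝕜 := ℝ)
      (f := iteratedFDeriv ℝ k u) (C := D * R ^ j)
      (fun y _ => hu.differentiable_iteratedFDeriv (by exact_mod_cast (by omega : k < r + 1)) y)
      (fun y hy => by
        rw [norm_fderiv_iteratedFDeriv]
        exact ih (by omega) y hy)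
      (mem_closedBall_self hR) hy
    rw [hz k (by omega), sub_zero] at h1
    refine h1.trans ?_
    have h2 : 0 ≤ D * R ^ j := (norm_nonneg _).trans (ih (k := k + 1) (by omega) y hy)
    rw [pow_succ, ← mul_assoc]
    gcongr
    simpa [dist_eq_norm] using hy

/-- A `C^{r+1}` map whose `r`-jet vanishes on `S` near `0` is `O(d(x, S)^{r+1})` near `0`, and its
derivative is `O(d(x, S)^r)`. -/
lemma exists_norm_le_infDist_pow {E F : Type*} [NormedAddCommGroup E]
    [NormedSpace ℝ E] [FiniteDimensional ℝ E] [NormedAddCommGroup F] [NormedSpace ℝ F]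
    {u : E → F} {r : ℕ} {S : Set E} (hS : IsClosed S) (h0 : (0 : E) ∈ S)
    (hu : ContDiff ℝ (r + 1 : ℕ) u)
    (hz : ∀ᶠ z in nhds (0 : E), z ∈ S → ∀ k ≤ r, iteratedFDeriv ℝ k u z = 0) :
    ∃ D ≥ (0 : ℝ), ∀ᶠ x in nhds (0 : E), ‖u x‖ ≤ D * infDist x S ^ (r + 1) ∧
      ‖fderiv ℝ u x‖ ≤ D * infDist x S ^ r := by
  obtain ⟨ρ, hρ, hz⟩ := Metric.eventually_nhds_iff.1 hz
  have : ProperSpace E := FiniteDimensional.proper ℝ E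
  obtain ⟨D, hD⟩ := (isCompact_closedBall (0 : E) ρ).exists_bound_of_continuousOn
    (hu.continuous_iteratedFDeriv (m := r + 1) le_rfl).continuousOn
  have hD0 : 0 ≤ D := (norm_nonneg _).trans (hD 0 (mem_closedBall_self hρ.le))
  refine ⟨D, hD0, Metric.eventually_nhds_iff.2 ⟨ρ / 3, by positivity, fun x hx => ?_⟩⟩
  obtain ⟨z, hzS, hxz⟩ := hS.exists_infDist_eq_dist ⟨0, h0⟩ x
  have hle : dist x z ≤ dist x 0 := hxz ▸ infDist_le_dist_of_mem h0
  have hz0 : dist z 0 < ρ := by linarith [dist_triangle z x 0, dist_comm x z]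
  have key := fun {j k : ℕ} (h : j + k = r + 1) =>
    norm_iteratedFDeriv_le_of_jet_eq_zero (R := dist x z) hu dist_nonneg (hz hz0 hzS)
      (fun y hy => hD y (by
        rw [mem_closedBall] at hy ⊢
        linarith [dist_triangle y z 0, dist_triangle z x 0, dist_comm x z])) h x
      (by simp)
  rw [hxz]
  exact ⟨by simpa using key (j := r + 1) (k := 0) rfl,
    by simpa only [norm_iteratedFDeriv_one] using key (j := r) (k := 1) rfl⟩

section Interpolation

open ContinuousLinearMap Filter Topology

/-- A strong form of the Kuo condition is stable under perturbations which are small relative to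
the distance to `S`. -/
lemma coercive_of_kuoD {n p r : ℕ} (hp : 1 ≤ p)
    {f : EuclideanSpace ℝ (Fin n) → EuclideanSpace ℝ (Fin p)} {x : EuclideanSpace ℝ (Fin n)}
    {A : EuclideanSpace ℝ (Fin n) →L[ℝ] EuclideanSpace ℝ (Fin p)} {y : EuclideanSpace ℝ (Fin p)}
    {d D m : ℝ} (hd : 0 < d) (hm : 0 ≤ m)
    (hf : p * (2 * m + 2 * D) * d ^ (r + 1) ≤ d * kuoD f x + ‖f x‖)
    (hA : ‖fderiv ℝ f x - A‖ ≤ D * d ^ r) (hy : ‖f x - y‖ ≤ D * d ^ (r + 1))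
    (w : EuclideanSpace ℝ (Fin p)) :
    (m * d ^ r) ^ 2 * ‖w‖ ^ 2 ≤ ‖adjoint A w‖ ^ 2 + (d⁻¹ * ‖y‖) ^ 2 * ‖w‖ ^ 2 := by
  set a := ‖adjoint A w‖ with ha
  set s := d⁻¹ * ‖y‖ with hs
  have hs0 : 0 ≤ s := by positivity
  have hp' : (1 : ℝ) ≤ p := by exact_mod_cast hp
  have hw := norm_nonneg w
  have hsd : ‖y‖ = d * s := by rw [hs, ← mul_assoc, mul_inv_cancel₀ hd.ne', one_mul]
  have h1 : kuoD f x * ‖w‖ ≤ p * (a + D * d ^ r * ‖w‖) := by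
    refine (kuoD_mul_norm_le f x w).trans ?_
    gcongr
    exact (norm_adjoint_sub_le _ A w).trans (by gcongr)
  have h2 : ‖f x‖ ≤ d * s + D * d ^ (r + 1) := by
    have := norm_le_norm_add_norm_sub' (f x) y
    linarith
  have h3 : d * (p * (2 * m + 2 * D) * d ^ r * ‖w‖) ≤
      d * (p * (a + D * d ^ r * ‖w‖) + (s + D * d ^ r) * ‖w‖) := by
    have e1 := mul_le_mul_of_nonneg_right hf hw
    have e2 := mul_le_mul_of_nonneg_right h2 hw
    have e3 := mul_le_mul_of_nonneg_left h1 hd.le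
    rw [pow_succ] at e1 e2
    linarith
  have h4 := le_of_mul_le_mul_left h3 hd
  have h5 : (s + D * d ^ r) * ‖w‖ ≤ p * ((s + D * d ^ r) * ‖w‖) := by
    refine le_mul_of_one_le_left (mul_nonneg (add_nonneg hs0 ?_) hw) hp'
    exact (norm_nonneg _).trans hA
  have h6 : p * (2 * (m * d ^ r * ‖w‖)) ≤ p * (a + s * ‖w‖) := by linarith
  have h7 := le_of_mul_le_mul_left h6 (by linarith)
  have h8 : 0 ≤ m * d ^ r * ‖w‖ := by positivity
  nlinarith [sq_nonneg (a - s * ‖w‖), sq_nonneg (m * d ^ r * ‖w‖)]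

lemma eventually_mul_infDist_pow_le {E : Type*} [NormedAddCommGroup E] {S : Set E}
    (h0 : (0 : E) ∈ S) {δ C : ℝ} (hδ : 0 < δ) (hC : 0 < C) (N : ℝ) (r : ℕ) :
    ∀ᶠ x in 𝓝 (0 : E), N * infDist x S ^ (r + 1) ≤ C * infDist x S ^ ((r : ℝ) + 1 - δ) := by
  have hlim : Tendsto (fun x => N * infDist x S ^ δ) (𝓝 (0 : E)) (𝓝 0) := by
    have hc : Continuous (fun x => N * infDist x S ^ δ) :=
      continuous_const.mul ((continuous_infDist_pt S).rpow_const fun _ => Or.inr hδ.le)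
    simpa [infDist_zero_of_mem h0, Real.zero_rpow hδ.ne'] using hc.tendsto 0
  filter_upwards [hlim.eventually_lt_const hC] with x hx
  rcases (infDist_nonneg (x := x) (s := S)).eq_or_lt with hd | hd
  · rw [← hd, zero_pow (by omega), mul_zero]
    exact mul_nonneg hC.le (Real.rpow_nonneg le_rfl _)
  · have h1 : infDist x S ^ (r + 1) = infDist x S ^ δ * infDist x S ^ ((r : ℝ) + 1 - δ) := by
      rw [← Real.rpow_add hd, ← Real.rpow_natCast]
      congr 1
      push_cast
      ring
    rw [h1, ← mul_assoc]
    have := Real.rpow_nonneg hd.le ((r : ℝ) + 1 - δ)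
    gcongr

variable {E F : Type*} [NormedAddCommGroup E] [InnerProductSpace ℝ E] [NormedAddCommGroup F]
  [InnerProductSpace ℝ F] [FiniteDimensional ℝ E] [FiniteDimensional ℝ F]

/-- The regularised field whose flow transports the zero set of `g` to that of `g + h`. -/
noncomputable def transportField (S : Set E) (g h : E → F) (t : ℝ) (x : E) : E :=
  regSolve (fderiv ℝ g x + t • fderiv ℝ h x) (((infDist x S)⁻¹ * ‖g x + t • h x‖) ^ 2) (h x)

lemma exists_lipschitzOnWith_transportField {S : Set E} {g h : E → F} {ε : ℝ} {T : Set E}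
    (hg : ContDiff ℝ 2 g) (hh : ContDiff ℝ 2 h) (hε : 0 < ε) (hT : IsCompact T)
    (hTε : ∀ x ∈ T, ε ≤ infDist x S)
    (hcoer : ∀ t ∈ Icc (0 : ℝ) 1, ∀ x ∈ T, ∃ m > 0, ∀ w, m ^ 2 * ‖w‖ ^ 2 ≤
      ‖adjoint (fderiv ℝ g x + t • fderiv ℝ h x) w‖ ^ 2 +
        ((infDist x S)⁻¹ * ‖g x + t • h x‖) ^ 2 * ‖w‖ ^ 2) :
    ∃ K, LipschitzOnWith K (fun q : ℝ × E => transportField S g h q.1 q.2)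
      (Icc (0 : ℝ) 1 ×ˢ T) := by
  refine LocallyLipschitzOn.exists_lipschitzOnWith_of_compact (isCompact_Icc.prod hT) ?_
  have hinv : LipschitzOnWith (Real.toNNReal (ε⁻¹ * ε⁻¹))
      (fun q : ℝ × E => (infDist q.2 S)⁻¹) (Icc (0 : ℝ) 1 ×ˢ T) := by
    refine LipschitzOnWith.of_dist_le_mul fun a ha b hb => ?_
    have h1 := (lipschitz_infDist_pt S).dist_le_mul b.2 a.2
    have ha' := hTε _ ha.2
    have hb' := hTε _ hb.2
    have ha0 : 0 < infDist a.2 S := hε.trans_le ha'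
    have hb0 : 0 < infDist b.2 S := hε.trans_le hb'
    have h2 : dist b.2 a.2 ≤ dist a b := by rw [dist_comm]; exact le_max_right _ _
    rw [Real.dist_eq] at h1 ⊢
    rw [inv_sub_inv ha0.ne' hb0.ne', abs_div, abs_of_pos (mul_pos ha0 hb0),
      Real.coe_toNNReal _ (by positivity), div_eq_inv_mul, mul_inv]
    simp only [NNReal.coe_one, one_mul] at h1
    gcongr
    exact h1.trans h2
  have hψ := (LipschitzWith.prod_fst.lipschitzOnWith (s := Icc (0 : ℝ) 1 ×ˢ T)).prodMk
    ((LipschitzWith.prod_snd.lipschitzOnWith (s := Icc (0 : ℝ) 1 ×ˢ T)).prodMk hinv)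
  intro q hq
  set Φ : ℝ × E × ℝ → E := fun y => regSolve (fderiv ℝ g y.2.1 + y.1 • fderiv ℝ h y.2.1)
    (y.2.2 ^ 2 * ‖g y.2.1 + y.1 • h y.2.1‖ ^ 2) (h y.2.1) with hΦ
  have hΦC : ContDiffAt ℝ 1 Φ (q.1, q.2, (infDist q.2 S)⁻¹) := by
    have hg1 : ContDiff ℝ 1 (fderiv ℝ g) := hg.fderiv_right (by norm_num)
    have hh1 : ContDiff ℝ 1 (fderiv ℝ h) := hh.fderiv_right (by norm_num)
    have hg0 : ContDiff ℝ 1 g := hg.of_le (by norm_num)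
    have hh0 : ContDiff ℝ 1 h := hh.of_le (by norm_num)
    refine ContDiffAt.regSolve ?_ ?_ ?_ ?_
    · exact ContDiff.contDiffAt (by fun_prop)
    · have : ContDiff ℝ 1 fun y : ℝ × E × ℝ => g y.2.1 + y.1 • h y.2.1 := by fun_prop
      have := this.norm_sq ℝ
      exact ContDiff.contDiffAt (by fun_prop)
    · exact ContDiff.contDiffAt (by fun_prop)
    · obtain ⟨m, hm, hmw⟩ := hcoer q.1 hq.1 q.2 hq.2
      simp only [← mul_pow]
      exact isUnit_regularised hm hmw
  obtain ⟨C, V, hV, hC⟩ := hΦC.exists_lipschitzOnWith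
  have heq : (fun q : ℝ × E => transportField S g h q.1 q.2) =
      Φ ∘ fun q : ℝ × E => (q.1, q.2, (infDist q.2 S)⁻¹) := by
    funext a
    simp [hΦ, transportField, mul_pow]
  rw [heq]
  exact ⟨_, _, inter_mem (hψ.continuousOn q hq hV) self_mem_nhdsWithin,
    hC.comp (hψ.mono inter_subset_right) fun a ha => ha.1⟩

lemma isTameField_cutoff_transportField {S : Set E} (h0 : (0 : E) ∈ S) {g h : E → F} {β : ℝ}
    (hβ : 0 < β) (hg : ContDiff ℝ 2 g) (hh : ContDiff ℝ 2 h)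
    (hle : ∀ t ∈ Icc (0 : ℝ) 1, ∀ x, ‖x‖ ≤ 2 * β → ‖transportField S g h t x‖ ≤ infDist x S)
    (hcoer : ∀ t ∈ Icc (0 : ℝ) 1, ∀ x, ‖x‖ ≤ 2 * β → 0 < infDist x S →
      ∃ m > 0, ∀ w, m ^ 2 * ‖w‖ ^ 2 ≤
        ‖adjoint (fderiv ℝ g x + t • fderiv ℝ h x) w‖ ^ 2 +
          ((infDist x S)⁻¹ * ‖g x + t • h x‖) ^ 2 * ‖w‖ ^ 2) :
    IsTameField S 1 (Real.toNNReal (2 * β))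
      (fun t x => unitClamp (2 - β⁻¹ * ‖x‖) • transportField S g h t x) := by
  have hφ0 : ∀ x : E, x ∉ closedBall (0 : E) (2 * β) → unitClamp (2 - β⁻¹ * ‖x‖) = 0 := by
    intro x hx
    apply unitClamp_of_nonpos
    rw [mem_closedBall_zero_iff, not_le] at hx
    have : β⁻¹ * (2 * β) ≤ β⁻¹ * ‖x‖ := by gcongr
    rw [mul_left_comm, inv_mul_cancel₀ hβ.ne'] at this
    linarith
  have hφlip : LipschitzWith (Real.toNNReal β⁻¹) fun x : E => unitClamp (2 - β⁻¹ * ‖x‖) := by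
    refine LipschitzWith.of_dist_le_mul fun y z => ?_
    refine (lipschitzWith_unitClamp.dist_le_mul _ _).trans ?_
    rw [Real.dist_eq, Real.coe_toNNReal _ (by positivity),
      show 2 - β⁻¹ * ‖y‖ - (2 - β⁻¹ * ‖z‖) = -(β⁻¹ * (‖y‖ - ‖z‖)) by ring, abs_neg, abs_mul,
      abs_of_pos (inv_pos.2 hβ), NNReal.coe_one, one_mul, dist_eq_norm]
    gcongr
    exact abs_norm_sub_norm_le y z
  have hdist : ∀ x : E, infDist x S ≤ ‖x‖ := fun x => by
    simpa using infDist_le_dist_of_mem (x := x) h0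
  have hbound : ∀ t ∈ Icc (0 : ℝ) 1, ∀ x,
      ‖unitClamp (2 - β⁻¹ * ‖x‖) • transportField S g h t x‖ ≤ min (infDist x S) (2 * β) := by
    intro t ht x
    by_cases hx : x ∈ closedBall (0 : E) (2 * β)
    · have hx' := mem_closedBall_zero_iff.1 hx
      rw [norm_smul]
      refine (mul_le_of_le_one_left (norm_nonneg _) (abs_unitClamp_le_one _)).trans ?_
      exact (hle t ht x hx').trans (le_min le_rfl ((hdist x).trans hx'))
    · rw [hφ0 x hx, zero_smul, norm_zero]
      exact le_min infDist_nonneg (by positivity)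
  have hLip : ∀ ε > 0, ∃ K, LipschitzOnWith K (fun q : ℝ × E => transportField S g h q.1 q.2)
      (Icc (0 : ℝ) 1 ×ˢ (closedBall (0 : E) (2 * β) ∩ {x | ε ≤ infDist x S})) := by
    intro ε hε
    have : ProperSpace E := FiniteDimensional.proper ℝ E
    exact exists_lipschitzOnWith_transportField hg hh hε
      ((isCompact_closedBall _ _).inter_right
        (isClosed_le continuous_const (continuous_infDist_pt S))) (fun x hx => hx.2)
      fun t ht x hx => hcoer t ht x (mem_closedBall_zero_iff.1 hx.1) (hε.trans_le hx.2)
  refine ⟨fun t ht x => ?_, fun t ht x => ?_, fun ε hε => ?_, fun x => ?_⟩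
  · rw [one_mul]
    exact (hbound t ht x).trans (min_le_left _ _)
  · rw [Real.coe_toNNReal _ (by positivity)]
    exact (hbound t ht x).trans (min_le_right _ _)
  · obtain ⟨K, hK⟩ := hLip ε hε
    refine ⟨_, fun t ht => LipschitzOnWith.cutoff_smul (T := closedBall (0 : E) (2 * β))
      (L := Real.toNNReal (2 * β)) (K := K) hφlip (fun x => abs_unitClamp_le_one _) hφ0 ?_ ?_⟩
    · have := hK.comp ((LipschitzWith.prodMk_left t).lipschitzOnWith
        (s := closedBall (0 : E) (2 * β) ∩ {x | ε ≤ infDist x S})) fun x hx => ⟨ht, hx⟩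
      simpa [Function.comp_def] using this
    · intro x hx
      have hx' := mem_closedBall_zero_iff.1 hx.1
      rw [Real.coe_toNNReal _ (by positivity)]
      exact (hle t ht x hx').trans ((hdist x).trans hx')
  · by_cases hx : x ∈ closedBall (0 : E) (2 * β)
    · refine ContinuousOn.const_smul ?_ _
      rcases (infDist_nonneg (x := x) (s := S)).eq_or_lt with hd | hd
      · refine (continuousOn_const (c := (0 : E))).congr fun t ht => ?_
        have := hle t ht x (mem_closedBall_zero_iff.1 hx)
        rw [← hd] at this
        exact norm_le_zero_iff.1 this
      · obtain ⟨K, hK⟩ := hLip _ hd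
        exact hK.continuousOn.comp (f := fun t : ℝ => (t, x)) (by fun_prop)
          fun t ht => ⟨ht, hx, le_refl (infDist x S)⟩
    · simp only [hφ0 x hx, zero_smul]
      exact continuousOn_const

/-- A field that almost solves the homological equation along a curve transports zeros. -/
lemma eq_zero_iff_of_transport {E F : Type*} [NormedAddCommGroup E] [NormedSpace ℝ E]
    [NormedAddCommGroup F] [NormedSpace ℝ F] {g h : E → F} (hg : Differentiable ℝ g)
    (hh : Differentiable ℝ h) {γ γ' : ℝ → E}
    (hγ : ∀ t ∈ Icc (0 : ℝ) 1, HasDerivWithinAt γ (γ' t) (Icc 0 1) t)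
    (hb : ∀ t ∈ Icc (0 : ℝ) 1, ‖h (γ t) + (fderiv ℝ g (γ t) + t • fderiv ℝ h (γ t)) (γ' t)‖ ≤
      ‖g (γ t) + t • h (γ t)‖) :
    g (γ 0) = 0 ↔ g (γ 1) + h (γ 1) = 0 := by
  have hu : ∀ t ∈ Icc (0 : ℝ) 1, HasDerivWithinAt (fun t => g (γ t) + t • h (γ t))
      (h (γ t) + (fderiv ℝ g (γ t) + t • fderiv ℝ h (γ t)) (γ' t)) (Icc 0 1) t := by
    intro t ht
    have h1 := (hg (γ t)).hasFDerivAt.comp_hasDerivWithinAt t (hγ t ht)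
    have h2 := (hh (γ t)).hasFDerivAt.comp_hasDerivWithinAt t (hγ t ht)
    have h3 := h1.add ((hasDerivWithinAt_id t (Icc (0 : ℝ) 1)).smul h2)
    refine h3.congr_deriv ?_
    simp only [id, one_smul, add_apply, smul_apply, Function.comp_apply]
    abel
  have key := fun {s t : ℝ} (hs : s ∈ Icc (0 : ℝ) 1) (ht : t ∈ Icc (0 : ℝ) 1) =>
    norm_le_exp_mul_of_norm_deriv_le zero_le_one hu (by simpa using hb) hs ht
  constructor
  · intro h0
    have := key (s := 0) (t := 1) (by simp) (by simp)
    simpa [h0] using this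
  · intro h0
    have := key (s := 1) (t := 0) (by simp) (by simp)
    simpa [h0] using this

end Interpolation

lemma jetEqual.eventually_iteratedFDeriv_sub_eq_zero {n p r : ℕ}
    {S : Set (EuclideanSpace ℝ (Fin n))}
    {f g₁ g₂ : EuclideanSpace ℝ (Fin n) → EuclideanSpace ℝ (Fin p)}
    (h₁ : jetEqual r S f g₁) (h₂ : jetEqual r S f g₂) (hg₁ : ContDiff ℝ (r + 1 : ℕ) g₁)
    (hg₂ : ContDiff ℝ (r + 1 : ℕ) g₂) :
    ∀ᶠ z in nhds (0 : EuclideanSpace ℝ (Fin n)), z ∈ S → ∀ k ≤ r,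
      iteratedFDeriv ℝ k (g₂ - g₁) z = 0 := by
  obtain ⟨U₁, hU₁, h₁⟩ := h₁
  obtain ⟨U₂, hU₂, h₂⟩ := h₂
  filter_upwards [hU₁, hU₂] with z hz₁ hz₂ hzS k hk
  have hk' : (k : WithTop ℕ∞) ≤ (r + 1 : ℕ) := by exact_mod_cast hk.trans (Nat.le_succ r)
  rw [iteratedFDeriv_sub_apply (hg₂.of_le hk').contDiffAt (hg₁.of_le hk').contDiffAt,
    ← h₁ z ⟨hzS, hz₁⟩ k hk, ← h₂ z ⟨hzS, hz₂⟩ k hk, sub_self]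

/-- If `d(x,Σ)·κ(df(x)) + ‖f(x)‖ ≥ C·d(x,Σ)^{r+1−δ}` near `0`, then `j^r f(Σ;0)` is
`Σ`-`V`-sufficient in `C^{r+1}` mappings. -/
theorem stmt19 {n p r : ℕ} (hr : 1 ≤ r) (hp : 1 ≤ p) (hnp : p ≤ n)
    (S : Set (EuclideanSpace ℝ (Fin n)))
    (hS : IsClosed S) (h0S : (0 : EuclideanSpace ℝ (Fin n)) ∈ S)
    (f : EuclideanSpace ℝ (Fin n) → EuclideanSpace ℝ (Fin p))
    (hf : ContDiff ℝ (r + 1) f) (hf0 : f 0 = 0)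
    (hyp : ∃ δ > (0:ℝ), ∃ C > (0:ℝ), ∃ α > (0:ℝ), ∀ x : EuclideanSpace ℝ (Fin n), ‖x‖ < α →
      Metric.infDist x S * kuoD f x + ‖f x‖ ≥
        C * Metric.infDist x S ^ ((r : ℝ) + 1 - δ)) :
    SigmaVSufficient r (r + 1) S f := by
  obtain ⟨δ, hδ, C, hC, α, hα, hyp⟩ := hyp
  intro g₁ g₂ hg₁ hg₂ _ _ hj₁ hj₂
  have hf' : ContDiff ℝ (r + 1 : ℕ) f := by exact_mod_cast hf
  have hjf : jetEqual r S f f := ⟨Set.univ, Filter.univ_mem, fun _ _ _ _ => rfl⟩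
  set h := g₂ - g₁ with hh
  have hhC : ContDiff ℝ (r + 1 : ℕ) h := hg₂.sub hg₁
  have htwo : (2 : WithTop ℕ∞) ≤ (r + 1 : ℕ) := by exact_mod_cast (by omega : 2 ≤ r + 1)
  obtain ⟨D, hD, hDh⟩ := exists_norm_le_infDist_pow hS h0S hhC
    (hj₁.eventually_iteratedFDeriv_sub_eq_zero hj₂ hg₁ hg₂)
  obtain ⟨D', hD', hDe⟩ := exists_norm_le_infDist_pow (u := f - g₁) hS h0S (hf'.sub hg₁)
    (hj₁.eventually_iteratedFDeriv_sub_eq_zero hjf hg₁ hf')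
  have hev := (hDh.and hDe).and ((eventually_mul_infDist_pow_le h0S hδ hC
    (p * (2 * (D + 1) + 2 * (D' + D))) r).and (ball_mem_nhds 0 hα))
  obtain ⟨ρ, hρ, hev⟩ := Metric.eventually_nhds_iff.1 hev
  have hd1 : Differentiable ℝ g₁ := hg₁.differentiable (by simp)
  have hdf : Differentiable ℝ f := hf'.differentiable (by simp)
  have hdh : Differentiable ℝ h := hhC.differentiable (by simp)
  have hcoer : ∀ t ∈ Icc (0 : ℝ) 1, ∀ x, ‖x‖ < ρ → 0 < infDist x S → ∀ w,
      ((D + 1) * infDist x S ^ r) ^ 2 * ‖w‖ ^ 2 ≤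
        ‖ContinuousLinearMap.adjoint (fderiv ℝ g₁ x + t • fderiv ℝ h x) w‖ ^ 2 +
          ((infDist x S)⁻¹ * ‖g₁ x + t • h x‖) ^ 2 * ‖w‖ ^ 2 := by
    intro t ht x hx hd w
    obtain ⟨⟨hxh, hxe⟩, hxN, hxα⟩ := hev (y := x) (by simpa using hx)
    have ht' : |t| ≤ 1 := abs_le.2 ⟨by linarith [ht.1], ht.2⟩
    refine coercive_of_kuoD hp hd (by positivity) (hxN.trans (hyp x (by simpa using hxα))) ?_ ?_ w
    · rw [← sub_sub, ← fderiv_sub (hdf x) (hd1 x)]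
      refine (norm_sub_le _ _).trans ?_
      rw [norm_smul, Real.norm_eq_abs]
      have := mul_le_mul ht' hxh.2 (norm_nonneg _) zero_le_one
      linarith [hxe.2]
    · rw [← sub_sub]
      refine (norm_sub_le _ _).trans ?_
      rw [norm_smul, Real.norm_eq_abs]
      have := mul_le_mul ht' hxh.1 (norm_nonneg _) zero_le_one
      have h2 := hxe.1
      rw [Pi.sub_apply] at h2
      linarith
  have hfield : ∀ t ∈ Icc (0 : ℝ) 1, ∀ x, ‖x‖ < ρ →
      ‖transportField S g₁ h t x‖ ≤ infDist x S ∧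
      ‖h x + (fderiv ℝ g₁ x + t • fderiv ℝ h x) (transportField S g₁ h t x)‖ ≤
        ‖g₁ x + t • h x‖ := by
    intro t ht x hx
    have hxh := (hev (y := x) (by simpa using hx)).1.1.1
    rcases (infDist_nonneg (x := x) (s := S)).eq_or_lt with hd | hd
    · rw [← hd, zero_pow (by omega), mul_zero, norm_le_zero_iff] at hxh
      simp [transportField, regSolve, hxh, infDist_nonneg]
    · have key := norm_regSolve_le (h := h x) (by positivity) (by positivity)
        (hcoer t ht x hx hd)
      have hle : ‖h x‖ / ((D + 1) * infDist x S ^ r) ≤ infDist x S := by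
        rw [div_le_iff₀ (by positivity)]
        refine hxh.trans ?_
        rw [pow_succ]
        have : 0 ≤ infDist x S ^ r * infDist x S := by positivity
        linarith
      refine ⟨key.1.trans hle, key.2.trans ?_⟩
      calc (infDist x S)⁻¹ * ‖g₁ x + t • h x‖ * (‖h x‖ / ((D + 1) * infDist x S ^ r))
          ≤ (infDist x S)⁻¹ * ‖g₁ x + t • h x‖ * infDist x S := by gcongr
        _ = ‖g₁ x + t • h x‖ := by field_simp
  set β := ρ / 3 with hβ
  have hβ0 : 0 < β := by positivity
  have hlt : ∀ x : EuclideanSpace ℝ (Fin n), ‖x‖ ≤ 2 * β → ‖x‖ < ρ := fun x hx => by linarith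
  have hX := isTameField_cutoff_transportField h0S hβ0 (hg₁.of_le htwo) (hhC.of_le htwo)
    (fun t ht x hx => (hfield t ht x (hlt x hx)).1)
    (fun t ht x hx hd => ⟨_, by positivity, hcoer t ht x (hlt x hx) hd⟩)
  obtain ⟨H, hH⟩ := hX.exists_homeomorph zero_le_one hS ⟨0, h0S⟩
  have hHS : ∀ x ∈ S, H x = x := by
    intro x hx
    obtain ⟨γ, hγ0, hγ1, hγ⟩ := hH x
    rw [← hγ1, IsTameField.eq_of_mem zero_le_one hX hγ (s := 0) (by simp) (by simp) (hγ0 ▸ hx),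
      hγ0]
  have hzero : ∀ x ∈ ball (0 : EuclideanSpace ℝ (Fin n)) (Real.exp (-1) * β),
      g₁ x = 0 ↔ g₂ (H x) = 0 := by
    intro x hx
    obtain ⟨γ, hγ0, hγ1, hγ⟩ := hH x
    have hγβ : ∀ t ∈ Icc (0 : ℝ) 1, ‖γ t‖ ≤ β := by
      intro t ht
      have h1 := IsTameField.norm_sub_le zero_le_one hX.norm_le hγ (s := 0) (by simp) ht h0S
      rw [sub_zero, sub_zero, hγ0] at h1
      refine h1.trans ?_
      have h2 : Real.exp 1 * ‖x‖ ≤ Real.exp 1 * (Real.exp (-1) * β) := by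
        gcongr
        exact (mem_ball_zero_iff.1 hx).le
      rwa [← mul_assoc, ← Real.exp_add, add_neg_cancel, Real.exp_zero, one_mul] at h2
    have key := eq_zero_iff_of_transport hd1 hdh (γ := γ)
      (γ' := fun t => transportField S g₁ h t (γ t)) (fun t ht => by
        have h1 : unitClamp (2 - β⁻¹ * ‖γ t‖) = 1 := by
          apply unitClamp_of_one_le
          have : β⁻¹ * ‖γ t‖ ≤ β⁻¹ * β := by gcongr; exact hγβ t ht
          rw [inv_mul_cancel₀ hβ0.ne'] at this
          linarith
        simpa only [h1, one_smul] using hγ t ht)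
      (fun t ht => (hfield t ht _ (hlt _ (by linarith [hγβ t ht]))).2)
    rw [hγ0, hγ1] at key
    rw [key, hh, Pi.sub_apply, add_sub_cancel]
  have hU : ball (0 : EuclideanSpace ℝ (Fin n)) (Real.exp (-1) * β) ∈ nhds 0 :=
    ball_mem_nhds _ (by positivity)
  refine ⟨_, hU, H '' ball 0 (Real.exp (-1) * β), ?_,
    H.subtype fun x => ?_, fun x hx => hHS _ hx⟩
  · have := H.isOpenMap.image_mem_nhds hU
    rwa [hHS 0 h0S] at this
  · simp only [mem_inter_iff, mem_preimage, mem_singleton_iff, H.injective.mem_set_image]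
    exact and_congr_left fun hx => hzero x hx
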